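/- Let n ≥ 2, let φ_j : ℂ → ℝ be subharmonic C²-functions such that each Δφ_j dλ is a nontrivial doubling measure on ℂ, for 1 ≤ j ≤ n, and set φ(z₁, …, zₙ) = φ₁(z₁) + ⋯ + φₙ(zₙ). Then the weighted Bergman space A²(ℂⁿ, e^{−φ}) of entire functions f with ∫_{ℂⁿ} |f|² e^{−φ} dλ < ∞ is an infinite-dimensional complex vector space. -/

import Mathlib

open MeasureTheory

/-- The partial derivative `∂φ/∂x` of `φ : ℂ → ℝ` (identifying `ℂ` with `ℝ²`, `z = x + iy`). -/
noncomputable def pdxR (φ : ℂ → ℝ) (z : ℂ) : ℝ := fderiv ℝ φ z 1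

/-- The partial derivative `∂φ/∂y` of `φ : ℂ → ℝ`. -/
noncomputable def pdyR (φ : ℂ → ℝ) (z : ℂ) : ℝ := fderiv ℝ φ z Complex.I

/-- The Laplacian `Δφ = ∂²φ/∂x² + ∂²φ/∂y²` of `φ : ℂ → ℝ`. -/
noncomputable def lap (φ : ℂ → ℝ) (z : ℂ) : ℝ :=
  pdxR (fun w => pdxR φ w) z + pdyR (fun w => pdyR φ w) z

open Filter Topology Set
open scoped ContDiff Convolution

/-- The Cauchy–Riemann operator `∂/∂x + i ∂/∂y`. -/
noncomputable def dbar (g : ℂ → ℂ) (z : ℂ) : ℂ :=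
  fderiv ℝ g z 1 + Complex.I * fderiv ℝ g z Complex.I

open ContinuousLinearMap in
theorem differentiable_convolution_of_weakly_holomorphic {u : ℂ → ℂ}
    (hu : LocallyIntegrable u)
    (hw : ∀ β : ℂ → ℂ, ContDiff ℝ ∞ β → HasCompactSupport β → ∫ z, u z * dbar β z = 0)
    {ρ : ℂ → ℝ} (hρ : ContDiff ℝ ∞ ρ) (hc : HasCompactSupport ρ) :
    Differentiable ℂ (ρ ⋆[lsmul ℝ ℝ, volume] u) := by
  intro x
  have hρ1 : ContDiff ℝ 1 ρ := hρ.of_le (by exact_mod_cast le_top)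
  have hd := hc.hasFDerivAt_convolution_left (lsmul ℝ ℝ) hρ1 hu x
  have key : ∀ e : ℂ, ((fderiv ℝ ρ ⋆[(lsmul ℝ ℝ).precompL ℂ, volume] u) x) e
      = ∫ t, (fderiv ℝ ρ (x - t) e) • u t := by
    intro e
    have hex : ConvolutionExistsAt (fderiv ℝ ρ) u x ((lsmul ℝ ℝ).precompL ℂ) volume :=
      (hc.fderiv ℝ).convolutionExists_left _ (hρ1.continuous_fderiv one_ne_zero) hu x
    rw [convolution_def, ContinuousLinearMap.integral_apply hex,
      ← integral_sub_left_eq_self _ _ x]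
    simp [ContinuousLinearMap.precompL_apply]
  rw [differentiableAt_complex_iff_differentiableAt_real]
  refine ⟨hd.differentiableAt, ?_⟩
  rw [hd.fderiv, key, key]
  set β : ℂ → ℂ := fun t => (ρ (x - t) : ℂ) with hβ
  have hβs : ContDiff ℝ ∞ β :=
    Complex.ofRealCLM.contDiff.comp (hρ.comp (contDiff_const.sub contDiff_id))
  have hβc : HasCompactSupport β := by
    have : HasCompactSupport (fun t => ρ (x - t)) :=
      hc.comp_homeomorph (Homeomorph.subLeft x)
    exact this.comp_left (g := fun r : ℝ => (r : ℂ)) (by simp)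
  have hβd : ∀ t e, fderiv ℝ β t e = -((fderiv ℝ ρ (x - t) e : ℝ) : ℂ) := by
    intro t e
    have h1 : HasFDerivAt ρ (fderiv ℝ ρ (x - t)) (x - t) :=
      (hρ1.differentiable one_ne_zero _).hasFDerivAt
    have h2 : HasFDerivAt (fun t : ℂ => x - t) (-ContinuousLinearMap.id ℝ ℂ) t :=
      (hasFDerivAt_id t).const_sub x
    have h3 := (Complex.ofRealCLM.hasFDerivAt (x := ρ (x - t))).comp t (h1.comp t h2)
    have h4 : HasFDerivAt β _ t := h3
    rw [h4.fderiv]; simp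
  have h0 := hw β hβs hβc
  have hinteg : ∀ e : ℂ, Integrable (fun t => (fderiv ℝ ρ (x - t) e) • u t) := by
    intro e
    have hcs : HasCompactSupport (fun t => fderiv ℝ ρ (x - t) e) := by
      have : HasCompactSupport (fun t => fderiv ℝ ρ (x - t)) :=
        (hc.fderiv ℝ).comp_homeomorph (Homeomorph.subLeft x)
      exact this.comp_left (g := fun L : ℂ →L[ℝ] ℝ => L e) (by simp)
    refine hu.integrable_smul_left_of_hasCompactSupport ?_ hcs
    exact ((hρ1.continuous_fderiv one_ne_zero).comp (by fun_prop)).clm_apply continuous_const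
  have h1 : ∀ t, u t * dbar β t = -((fderiv ℝ ρ (x - t) 1) • u t
      + Complex.I * ((fderiv ℝ ρ (x - t) Complex.I) • u t)) := by
    intro t
    simp only [dbar, hβd, Complex.real_smul]; ring
  simp_rw [h1] at h0
  rw [integral_neg, integral_add (hinteg 1) ((hinteg Complex.I).const_mul _),
    integral_const_mul] at h0
  have h2 : (∫ t, (fderiv ℝ ρ (x - t) 1) • u t)
      = - (Complex.I * ∫ t, (fderiv ℝ ρ (x - t) Complex.I) • u t) := by
    linear_combination -h0
  rw [h2, smul_eq_mul]
  linear_combination (∫ t, (fderiv ℝ ρ (x - t) Complex.I) • u t) * Complex.I_sq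

open ContinuousLinearMap in
/-- Entire functions are fixed by convolution against normalised radial kernels. -/
theorem convolution_radial_eq_self {g : ℂ → ℂ} (hg : Differentiable ℂ g) {q : ℝ → ℝ}
    (hq : Continuous q) (hq0 : ∀ r, 1 ≤ r → q r = 0) (h1 : ∫ z : ℂ, q ‖z‖ = 1) (x : ℂ) :
    ((fun z : ℂ => q ‖z‖) ⋆[lsmul ℝ ℝ, volume] g) x = g x := by
  have polar : ∀ F : ℂ → ℂ, Continuous F →
      ∫ z : ℂ, q ‖z‖ • F z = ∫ r in Ioi (0 : ℝ), (r * q r) •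
        ∫ θ in Ioo (-Real.pi) Real.pi, F (Complex.polarCoord.symm (r, θ)) := by
    intro F hF
    have hps : Continuous fun p : ℝ × ℝ => Complex.polarCoord.symm p := by
      simp only [Complex.polarCoord_symm_apply]; fun_prop
    have hF' : IntegrableOn (fun p : ℝ × ℝ => p.1 • (q ‖Complex.polarCoord.symm p‖ •
        F (Complex.polarCoord.symm p))) (Ioi 0 ×ˢ Ioo (-Real.pi) Real.pi)
        (volume.prod volume) := by
      have hK : IntegrableOn (fun p : ℝ × ℝ => p.1 • (q ‖Complex.polarCoord.symm p‖ •
          F (Complex.polarCoord.symm p))) (Icc 0 1 ×ˢ Icc (-Real.pi) Real.pi)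
          (volume.prod volume) :=
        (Continuous.continuousOn (by fun_prop)).integrableOn_compact
          (isCompact_Icc.prod isCompact_Icc)
      refine hK.of_forall_sdiff_eq_zero (measurableSet_Ioi.prod measurableSet_Ioo) ?_
      rintro ⟨r, θ⟩ ⟨⟨hr, hθ⟩, hn⟩
      have : 1 ≤ r := by
        by_contra h
        exact hn ⟨⟨(mem_Ioi.1 hr).le, (not_le.1 h).le⟩, Ioo_subset_Icc_self hθ⟩
      simp only [Complex.norm_polarCoord_symm, abs_of_pos (mem_Ioi.1 hr)]
      simp [hq0 r this]
    rw [← Complex.integral_comp_polarCoord_symm]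
    change ∫ p in Ioi (0 : ℝ) ×ˢ Ioo (-Real.pi) Real.pi, _ ∂(volume.prod volume) = _
    rw [setIntegral_prod _ hF']
    refine setIntegral_congr_fun measurableSet_Ioi fun r hr => ?_
    simp only [Complex.norm_polarCoord_symm, abs_of_pos (mem_Ioi.1 hr)]
    rw [← integral_smul]
    simp [mul_assoc]
  have mean : ∀ r : ℝ, ∫ θ in Ioo (-Real.pi) Real.pi, g (x - Complex.polarCoord.symm (r, θ))
      = (2 * Real.pi : ℝ) • g x := by
    intro r
    have hm := (hg.diffContOnCl (s := Metric.ball x |(-r)|)).circleAverage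
    rw [Real.circleAverage_def, inv_smul_eq_iff₀ (by positivity)] at hm
    rw [← hm, ← integral_Ioc_eq_integral_Ioo, ← intervalIntegral.integral_of_le
      (by linarith [Real.pi_pos])]
    have hper : Function.Periodic (fun θ => g (circleMap x (-r) θ)) (2 * Real.pi) :=
      (periodic_circleMap x (-r)).comp g
    have := hper.intervalIntegral_add_eq (-Real.pi) 0
    rw [show -Real.pi + 2 * Real.pi = Real.pi by ring, zero_add] at this
    rw [← this]
    congr 1; ext θ; congr 1
    simp [circleMap, Complex.exp_mul_I]; ring
  have hone : ∫ z : ℂ, q ‖z‖ • (1 : ℂ) = 1 := by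
    rw [integral_smul_const, h1, one_smul]
  rw [convolution_def]
  change ∫ z : ℂ, q ‖z‖ • g (x - z) = _
  rw [polar (fun z => g (x - z)) (hg.continuous.comp (by fun_prop))]
  rw [polar _ continuous_const] at hone
  simp_rw [mean]
  have : ∀ r : ℝ, (r * q r) • ((2 * Real.pi : ℝ) • g x)
      = ((r * q r) • ∫ θ in Ioo (-Real.pi) Real.pi, (1 : ℂ)) * g x := by
    intro r
    simp [Real.pi_pos.le]; ring
  simp_rw [this]
  rw [integral_mul_const, hone, one_mul]

open ContinuousLinearMap in
/-- **Weyl's lemma** for the Cauchy–Riemann operator. -/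
theorem exists_entire_ae_eq_of_weakly_holomorphic {u : ℂ → ℂ} (hu : LocallyIntegrable u)
    (hw : ∀ β : ℂ → ℂ, ContDiff ℝ ∞ β → HasCompactSupport β → ∫ z, u z * dbar β z = 0) :
    ∃ h : ℂ → ℂ, Differentiable ℂ h ∧ u =ᵐ[volume] h := by
  set q₀ : ℝ → ℝ := fun r => Real.smoothTransition (1 - r ^ 2) with hq₀
  have hq₀c : Continuous q₀ := by fun_prop
  have hq₀0 : ∀ r, 1 ≤ r → q₀ r = 0 := fun r hr =>
    Real.smoothTransition.zero_of_nonpos (by nlinarith)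
  have hs₀ : ContDiff ℝ ∞ (fun z : ℂ => q₀ ‖z‖) :=
    Real.smoothTransition.contDiff.comp (contDiff_const.sub (contDiff_norm_sq ℝ))
  have hsupp : ∀ c : ℝ, HasCompactSupport (fun z : ℂ => c * q₀ ‖z‖) := fun c =>
    HasCompactSupport.intro (isCompact_closedBall (0 : ℂ) 1) fun z hz => by
      rw [hq₀0, mul_zero]
      simpa using (not_le.1 fun h => hz (by simpa using h)).le
  have hpos : 0 < ∫ z : ℂ, q₀ ‖z‖ := by
    refine (hs₀.continuous.integral_pos_of_hasCompactSupport_nonneg_nonzero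
      (by simpa using hsupp 1) (fun z => Real.smoothTransition.nonneg _) (x := 0) ?_)
    simp [hq₀]
  set c := (∫ z : ℂ, q₀ ‖z‖)⁻¹ with hcdef
  set q : ℝ → ℝ := fun r => c * q₀ r with hqdef
  set ρ : ℂ → ℝ := fun z => q ‖z‖ with hρdef
  have hρs : ContDiff ℝ ∞ ρ := contDiff_const.mul hs₀
  have hρc : HasCompactSupport ρ := hsupp c
  have hρ1 : ∫ z : ℂ, q ‖z‖ = 1 := by
    simp only [hqdef]; rw [integral_const_mul, hcdef, inv_mul_cancel₀ hpos.ne']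
  have hwd : Differentiable ℂ (ρ ⋆[lsmul ℝ ℝ, volume] u) :=
    differentiable_convolution_of_weakly_holomorphic hu hw hρs hρc
  refine ⟨_, hwd, ?_⟩
  let b : ℕ → ContDiffBump (0 : ℂ) := fun k =>
    ⟨1 / (k + 1 : ℝ) , 2 * (1 / (k + 1 : ℝ)), by positivity, by
      have : 0 < 1 / (k + 1 : ℝ) := by positivity
      linarith⟩
  have hb : Tendsto (fun k => (b k).rOut) atTop (𝓝 0) := by
    have := (tendsto_one_div_add_atTop_nhds_zero_nat (𝕜 := ℝ)).const_mul 2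
    rwa [mul_zero] at this
  filter_upwards [ContDiffBump.ae_convolution_tendsto_right_of_locallyIntegrable
    (K := 2) hb (Eventually.of_forall fun k => le_rfl) hu] with x hx
  refine tendsto_nhds_unique hx ?_
  have hlim := ContDiffBump.convolution_tendsto_right_of_continuous (μ := volume) hb
    hwd.continuous x
  refine hlim.congr fun k => ?_
  set η := (b k).normed volume with hη
  have hηs : ContDiff ℝ ∞ η := (b k).contDiff_normed
  have hηc : HasCompactSupport η := (b k).hasCompactSupport_normed
  have hv : Differentiable ℂ (η ⋆[lsmul ℝ ℝ, volume] u) :=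
    differentiable_convolution_of_weakly_holomorphic hu hw hηs hηc
  have assoc : ∀ f g : ℂ → ℝ, Continuous f → Continuous g → HasCompactSupport f →
      HasCompactSupport g →
      ((f ⋆[lsmul ℝ ℝ, volume] g) ⋆[lsmul ℝ ℝ, volume] u) x
        = (f ⋆[lsmul ℝ ℝ, volume] (g ⋆[lsmul ℝ ℝ, volume] u)) x := by
    intro f g hf hg hfc hgc
    have hun : LocallyIntegrable (fun z => ‖u z‖) := fun z => (hu z).norm
    refine convolution_assoc _ _ _ _ (fun a b c => by simp [mul_smul]) hf.aestronglyMeasurable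
      hg.aestronglyMeasurable hu.aestronglyMeasurable
      (Eventually.of_forall (hfc.convolutionExists_left _ hf hg.locallyIntegrable))
      (Eventually.of_forall (hgc.norm.convolutionExists_left _ hg.norm hun)) ?_
    refine hfc.norm.convolutionExists_left _ hf.norm ?_ x
    exact (hgc.norm.continuous_convolution_left _ hg.norm hun).locallyIntegrable
  rw [← assoc _ _ hηs.continuous hρs.continuous hηc hρc]
  rw [← convolution_radial_eq_self hv (q := q) (by fun_prop)
    (fun r hr => by simp [hqdef, hq₀0 r hr]) hρ1 x]
  rw [← assoc _ _ hρs.continuous hηs.continuous hρc hηc]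
  congr 1
  have := convolution_flip (f := η) (g := ρ) (L := lsmul ℝ ℝ) (μ := (volume : Measure ℂ))
  rw [← this]
  congr 1
  ext; simp

theorem integral_fderiv_apply_eq_zero {g : ℂ → ℂ} (hg : ContDiff ℝ 1 g)
    (hc : HasCompactSupport g) (e : ℂ) : ∫ z, fderiv ℝ g z e = 0 := by
  have hi : Integrable (fun z => fderiv ℝ g z e) :=
    ((hg.continuous_fderiv one_ne_zero).clm_apply continuous_const).integrable_of_hasCompactSupport
      ((hc.fderiv ℝ).comp_left (g := fun L : ℂ →L[ℝ] ℂ => L e) (by simp))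
  have := integral_mul_fderiv_eq_neg_fderiv_mul_of_integrable (μ := (volume : Measure ℂ))
    (f := fun _ : ℂ => (1 : ℂ)) (g := g) (v := e) (by simp) (by simpa using hi)
    (by simpa using hg.continuous.integrable_of_hasCompactSupport hc)
    (fun _ _ => differentiableAt_const _) (fun x _ => hg.differentiable one_ne_zero x)
  simpa using this

theorem fderiv_apply_fderiv_comm {F : Type*} [NormedAddCommGroup F] [NormedSpace ℝ F]
    {g : ℂ → F} (hg : ContDiff ℝ 2 g) (z e e' : ℂ) :
    fderiv ℝ (fun w => fderiv ℝ g w e) z e' = fderiv ℝ (fun w => fderiv ℝ g w e') z e := by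
  have hd : DifferentiableAt ℝ (fderiv ℝ g) z :=
    (hg.fderiv_right (m := 1) (by norm_num)).differentiable one_ne_zero z
  have h := (hg.contDiffAt (x := z)).isSymmSndFDerivAt (by simp)
  rw [fderiv_clm_apply hd (differentiableAt_const _), fderiv_clm_apply hd (differentiableAt_const _)]
  simpa using h e' e

theorem contDiff_fderiv_apply {F : Type*} [NormedAddCommGroup F] [NormedSpace ℝ F]
    {g : ℂ → F} (hg : ContDiff ℝ 2 g) (e : ℂ) : ContDiff ℝ 1 (fun w => fderiv ℝ g w e) :=
  (hg.fderiv_right (m := 1) (by norm_num)).clm_apply contDiff_const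

theorem continuous_lap {φ : ℂ → ℝ} (hφ : ContDiff ℝ 2 φ) : Continuous (lap φ) := by
  have h : ∀ e : ℂ, Continuous fun z => fderiv ℝ (fun w => fderiv ℝ φ w e) z e := fun e =>
    ((contDiff_fderiv_apply hφ e).continuous_fderiv one_ne_zero).clm_apply continuous_const
  exact (h 1).add (h Complex.I)

theorem continuous_dbar {g : ℂ → ℂ} (hg : ContDiff ℝ 1 g) : Continuous (dbar g) := by
  have h : ∀ e : ℂ, Continuous fun z => fderiv ℝ g z e := fun e =>
    (hg.continuous_fderiv one_ne_zero).clm_apply continuous_const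
  exact (h 1).add (continuous_const.mul (h Complex.I))

theorem HasCompactSupport.dbar {g : ℂ → ℂ} (hc : HasCompactSupport g) :
    HasCompactSupport (dbar g) :=
  (hc.fderiv ℝ).comp_left (g := fun L : ℂ →L[ℝ] ℂ => L 1 + Complex.I * L Complex.I) (by simp)

/-- The weighted energy inequality underlying Hörmander's estimate in one variable. -/
theorem integral_lap_mul_le_integral_dbar {ψ : ℂ → ℝ} (hψ : ContDiff ℝ 2 ψ) {β : ℂ → ℂ}
    (hβ : ContDiff ℝ 2 β) (hc : HasCompactSupport β) :
    ∫ z, lap ψ z * ‖β z‖ ^ 2 * Real.exp (ψ z) ≤ ∫ z, ‖dbar β z‖ ^ 2 * Real.exp (ψ z) := by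
  set E : ℂ → ℂ := fun z => (Real.exp (ψ z) : ℂ) with hE
  set b : ℂ → ℂ := fun z => (starRingEnd ℂ) (β z) with hb
  set X : ℂ → ℝ := fun z => fderiv ℝ ψ z 1 with hX
  set Y : ℂ → ℝ := fun z => fderiv ℝ ψ z Complex.I with hY
  set S : ℂ → ℂ := fun z => (X z : ℂ) - Complex.I * (Y z : ℂ) with hS
  set U : ℂ → ℂ := fun z => fderiv ℝ β z 1 with hU
  set V : ℂ → ℂ := fun z => fderiv ℝ β z Complex.I with hV
  have cE : ContDiff ℝ 1 E :=
    Complex.ofRealCLM.contDiff.comp (Real.contDiff_exp.comp (hψ.of_le (by norm_num)))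
  have cβ : ContDiff ℝ 1 β := hβ.of_le (by norm_num)
  have cψ : ContDiff ℝ 1 ψ := hψ.of_le (by norm_num)
  have cb : ContDiff ℝ 1 b := Complex.conjCLE.contDiff.comp cβ
  have cX : ContDiff ℝ 1 X := contDiff_fderiv_apply hψ 1
  have cY : ContDiff ℝ 1 Y := contDiff_fderiv_apply hψ Complex.I
  have cX' : ContDiff ℝ 1 (fun z => (X z : ℂ)) := Complex.ofRealCLM.contDiff.comp cX
  have cY' : ContDiff ℝ 1 (fun z => (Y z : ℂ)) := Complex.ofRealCLM.contDiff.comp cY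
  have cS : ContDiff ℝ 1 S := cX'.sub (contDiff_const.mul cY')
  have cU : ContDiff ℝ 1 U := contDiff_fderiv_apply hβ 1
  have cV : ContDiff ℝ 1 V := contDiff_fderiv_apply hβ Complex.I
  have dm : ∀ {p q : ℂ → ℂ}, ContDiff ℝ 1 p → ContDiff ℝ 1 q → ∀ z e,
      fderiv ℝ (fun w => p w * q w) z e = p z * fderiv ℝ q z e + fderiv ℝ p z e * q z := by
    intro p q hp hq z e
    rw [fderiv_fun_mul (hp.differentiable one_ne_zero z) (hq.differentiable one_ne_zero z)]
    simp [mul_comm]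
  have da : ∀ {p q : ℂ → ℂ}, ContDiff ℝ 1 p → ContDiff ℝ 1 q → ∀ z e,
      fderiv ℝ (fun w => p w + q w) z e = fderiv ℝ p z e + fderiv ℝ q z e := by
    intro p q hp hq z e
    rw [fderiv_fun_add (hp.differentiable one_ne_zero z) (hq.differentiable one_ne_zero z)]
    simp
  have ds : ∀ {p q : ℂ → ℂ}, ContDiff ℝ 1 p → ContDiff ℝ 1 q → ∀ z e,
      fderiv ℝ (fun w => p w - q w) z e = fderiv ℝ p z e - fderiv ℝ q z e := by
    intro p q hp hq z e
    rw [fderiv_fun_sub (hp.differentiable one_ne_zero z) (hq.differentiable one_ne_zero z)]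
    simp
  have dr : ∀ {p : ℂ → ℝ}, ContDiff ℝ 1 p → ∀ z e,
      fderiv ℝ (fun w => (p w : ℂ)) z e = (fderiv ℝ p z e : ℂ) := by
    intro p hp z e
    have := (Complex.ofRealCLM.hasFDerivAt (x := p z)).comp z
      (hp.differentiable one_ne_zero z).hasFDerivAt
    have h2 : HasFDerivAt (fun w => (p w : ℂ)) _ z := this
    rw [h2.fderiv]; simp
  have dE : ∀ z e, fderiv ℝ E z e = E z * (fderiv ℝ ψ z e : ℂ) := by
    intro z e
    have ce : ContDiff ℝ 1 (fun w => Real.exp (ψ w)) := Real.contDiff_exp.comp cψ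
    rw [hE, dr ce, fderiv_exp (cψ.differentiable one_ne_zero z)]
    simp
  have db : ∀ z e, fderiv ℝ b z e = (starRingEnd ℂ) (fderiv ℝ β z e) := by
    intro z e
    have := (Complex.conjCLE.hasFDerivAt (x := β z)).comp z
      (cβ.differentiable one_ne_zero z).hasFDerivAt
    have h2 : HasFDerivAt b _ z := this
    rw [h2.fderiv]; simp
  have dS : ∀ z e, fderiv ℝ S z e = (fderiv ℝ X z e : ℂ) - Complex.I * (fderiv ℝ Y z e : ℂ) := by
    intro z e
    rw [hS, ds cX' (contDiff_const.mul cY'), dr cX, dm contDiff_const cY', dr cY]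
    simp
  set P : ℂ → ℂ := fun z => E z * (b z * (2 * Complex.I * V z - S z * β z)) with hP
  set Q : ℂ → ℂ := fun z => E z * (b z * (-Complex.I * (2 * U z + S z * β z))) with hQ
  have c1 : ContDiff ℝ 1 (fun z => 2 * Complex.I * V z) := contDiff_const.mul cV
  have c2 : ContDiff ℝ 1 (fun z => S z * β z) := cS.mul cβ
  have c3 : ContDiff ℝ 1 (fun z => 2 * U z) := contDiff_const.mul cU
  have c4 : ContDiff ℝ 1 (fun z => -Complex.I * (2 * U z + S z * β z)) :=
    contDiff_const.mul (c3.add c2)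
  have cP : ContDiff ℝ 1 P := cE.mul (cb.mul (c1.sub c2))
  have cQ : ContDiff ℝ 1 Q := cE.mul (cb.mul c4)
  have hbc : HasCompactSupport b := hc.comp_left (g := starRingEnd ℂ) (by simp)
  have hPc : HasCompactSupport P := HasCompactSupport.mul_left (hbc.mul_right)
  have hQc : HasCompactSupport Q := HasCompactSupport.mul_left (hbc.mul_right)
  set W : ℂ → ℂ := fun z => U z - Complex.I * V z + S z * β z with hW
  have div : ∀ z, fderiv ℝ P z 1 + fderiv ℝ Q z Complex.I =
      ((‖dbar β z‖ ^ 2 * Real.exp (ψ z) - ‖W z‖ ^ 2 * Real.exp (ψ z)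
        - lap ψ z * ‖β z‖ ^ 2 * Real.exp (ψ z) : ℝ) : ℂ) := by
    intro z
    have sym1 : fderiv ℝ U z Complex.I = fderiv ℝ V z 1 := fderiv_apply_fderiv_comm hβ z _ _
    have sym2 : fderiv ℝ X z Complex.I = fderiv ℝ Y z 1 := fderiv_apply_fderiv_comm hψ z _ _
    have hl : lap ψ z = fderiv ℝ X z 1 + fderiv ℝ Y z Complex.I := rfl
    have hdb : dbar β z = U z + Complex.I * V z := rfl
    have hU' : fderiv ℝ β z 1 = U z := rfl
    have hV' : fderiv ℝ β z Complex.I = V z := rfl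
    have hX' : fderiv ℝ ψ z 1 = X z := rfl
    have hY' : fderiv ℝ ψ z Complex.I = Y z := rfl
    have hbz : b z = (starRingEnd ℂ) (β z) := rfl
    rw [hP, hQ, dm cE (cb.mul (c1.sub c2)), dm cE (cb.mul c4), dm cb (c1.sub c2), dm cb c4,
      ds c1 c2, dm contDiff_const (c3.add c2), da c3 c2, dm contDiff_const cV,
      dm contDiff_const cU, dm cS cβ, dm cS cβ, dE, dE, db, db, dS, dS, sym1, sym2]
    push_cast
    rw [← Complex.mul_conj', ← Complex.mul_conj', ← Complex.mul_conj', hl, hdb, hU', hV', hX', hY']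
    simp only [hW, hS, hbz, hE, map_add, map_sub, map_mul, Complex.conj_I, Complex.conj_ofReal]
    simp only [fderiv_fun_const, Pi.zero_apply, zero_apply]
    push_cast
    ring_nf
    simp only [Complex.I_sq]
    ring
  have i1 : Integrable (fun z => fderiv ℝ P z 1) :=
    ((cP.continuous_fderiv one_ne_zero).clm_apply continuous_const).integrable_of_hasCompactSupport
      ((hPc.fderiv ℝ).comp_left (g := fun L : ℂ →L[ℝ] ℂ => L 1) (by simp))
  have i2 : Integrable (fun z => fderiv ℝ Q z Complex.I) :=
    ((cQ.continuous_fderiv one_ne_zero).clm_apply continuous_const).integrable_of_hasCompactSupport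
      ((hQc.fderiv ℝ).comp_left (g := fun L : ℂ →L[ℝ] ℂ => L Complex.I) (by simp))
  have tot : ∫ z, (fderiv ℝ P z 1 + fderiv ℝ Q z Complex.I) = 0 := by
    rw [integral_add i1 i2, integral_fderiv_apply_eq_zero cP hPc,
      integral_fderiv_apply_eq_zero cQ hQc, add_zero]
  simp_rw [div] at tot
  rw [integral_complex_ofReal] at tot
  norm_cast at tot
  have ec : Continuous (fun z => Real.exp (ψ z)) := Real.continuous_exp.comp cψ.continuous
  have cW : Continuous W :=
    (cU.continuous.sub (continuous_const.mul cV.continuous)).add c2.continuous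
  have hWc : HasCompactSupport W := by
    have hUc : HasCompactSupport U :=
      (hc.fderiv ℝ).comp_left (g := fun L : ℂ →L[ℝ] ℂ => L 1) (by simp)
    have hVc : HasCompactSupport V :=
      (hc.fderiv ℝ).comp_left (g := fun L : ℂ →L[ℝ] ℂ => L Complex.I) (by simp)
    exact (hUc.sub (hVc.mul_left)).add (hc.mul_left)
  have sqc : ∀ {p : ℂ → ℂ}, HasCompactSupport p → HasCompactSupport (fun z => ‖p z‖ ^ 2) :=
    fun hp => hp.comp_left (g := fun w : ℂ => ‖w‖ ^ 2) (by simp)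
  have j1 : Integrable (fun z => ‖dbar β z‖ ^ 2 * Real.exp (ψ z)) :=
    (((continuous_dbar cβ).norm.pow 2).mul ec).integrable_of_hasCompactSupport
      (sqc hc.dbar).mul_right
  have j2 : Integrable (fun z => ‖W z‖ ^ 2 * Real.exp (ψ z)) :=
    ((cW.norm.pow 2).mul ec).integrable_of_hasCompactSupport (sqc hWc).mul_right
  have j3 : Integrable (fun z => lap ψ z * ‖β z‖ ^ 2 * Real.exp (ψ z)) :=
    (((continuous_lap hψ).mul (cβ.continuous.norm.pow 2)).mul ec).integrable_of_hasCompactSupport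
      ((sqc hc).mul_left).mul_right
  have split : ∫ z, (‖dbar β z‖ ^ 2 * Real.exp (ψ z) - ‖W z‖ ^ 2 * Real.exp (ψ z)
      - lap ψ z * ‖β z‖ ^ 2 * Real.exp (ψ z)) = _ := integral_sub (j1.sub j2) j3
  have split' : ∫ z, (‖dbar β z‖ ^ 2 * Real.exp (ψ z)
      - ‖W z‖ ^ 2 * Real.exp (ψ z)) = _ := integral_sub j1 j2
  rw [split, split'] at tot
  have : 0 ≤ ∫ z, ‖W z‖ ^ 2 * Real.exp (ψ z) := integral_nonneg fun z => by positivity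
  linarith

/-- A linear functional dominated by the seminorm `‖A ·‖` factors through `A` as an inner product. -/
theorem exists_inner_eq_of_norm_le {W H : Type*} [AddCommGroup W] [Module ℂ W]
    [NormedAddCommGroup H] [InnerProductSpace ℂ H] [CompleteSpace H] (A : W →ₗ[ℂ] H)
    (l : W →ₗ[ℂ] ℂ) (C : ℝ) (h : ∀ w, ‖l w‖ ≤ C * ‖A w‖) :
    ∃ y : H, ∀ w, inner ℂ y (A w) = l w := by
  have hl : l ∈ LinearMap.range A.dualMap := by
    rw [LinearMap.range_dualMap_eq_dualAnnihilator_ker, Submodule.mem_dualAnnihilator]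
    intro w hw
    have := h w
    rw [LinearMap.mem_ker.1 hw, norm_zero, mul_zero] at this
    exact norm_le_zero_iff.1 this
  obtain ⟨m, hm⟩ := hl
  have hm' : ∀ w, m (A w) = l w := fun w => by rw [← hm]; rfl
  let R := LinearMap.range A
  let m₀ : R →L[ℂ] ℂ := (m.comp R.subtype).mkContinuous C (by
    rintro ⟨_, w, rfl⟩
    simpa [hm'] using h w)
  obtain ⟨g, hg, -⟩ := exists_extension_norm_eq R m₀
  refine ⟨(InnerProductSpace.toDual ℂ H).symm g, fun w => ?_⟩
  rw [InnerProductSpace.toDual_symm_apply, ← hm']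
  exact hg ⟨A w, w, rfl⟩

/-- Solvability of `dbar v = f` in the weak sense, with weighted `L²` bounds, from an a priori
estimate. -/
theorem exists_weak_dbar_solution {ψ : ℂ → ℝ} (hψ : Continuous ψ) {f : ℂ → ℂ}
    (hf : Continuous f) (C : ℝ)
    (hC : ∀ β : ℂ → ℂ, ContDiff ℝ ∞ β → HasCompactSupport β →
      ‖∫ z, f z * β z‖ ≤ C * √(∫ z, ‖dbar β z‖ ^ 2 * Real.exp (ψ z))) :
    ∃ v : ℂ → ℂ, LocallyIntegrable v ∧ Integrable (fun z => ‖v z‖ ^ 2 * Real.exp (-ψ z)) ∧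
      ∀ β : ℂ → ℂ, ContDiff ℝ ∞ β → HasCompactSupport β →
        ∫ z, v z * dbar β z = ∫ z, f z * β z := by
  let W : Submodule ℂ (ℂ → ℂ) :=
    { carrier := {β | ContDiff ℝ ∞ β ∧ HasCompactSupport β}
      add_mem' := fun ha hb => ⟨ha.1.add hb.1, ha.2.add hb.2⟩
      zero_mem' := ⟨contDiff_const, HasCompactSupport.zero⟩
      smul_mem' := fun c a ha => ⟨contDiff_const.smul ha.1, ha.2.smul_left (f := fun _ => c)⟩ }
  have c1 : ∀ β : W, ContDiff ℝ 1 (β : ℂ → ℂ) := fun β => β.2.1.of_le (by exact_mod_cast le_top)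
  have dd : ∀ (β : W) z, DifferentiableAt ℝ (β : ℂ → ℂ) z := fun β z =>
    (c1 β).differentiable one_ne_zero z
  set w : ℂ → ℂ := fun z => (Real.exp (ψ z / 2) : ℂ) with hw
  have wc : Continuous w := by fun_prop
  have hmem : ∀ β : W, MemLp (fun z => dbar β z * w z) 2 (volume : Measure ℂ) := fun β =>
    ((continuous_dbar (c1 β)).mul wc).memLp_of_hasCompactSupport β.2.2.dbar.mul_right
  have dadd : ∀ (a b : W) z, dbar ((a + b : W) : ℂ → ℂ) z = dbar a z + dbar b z := by
    intro a b z
    simp only [dbar, Submodule.coe_add]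
    rw [fderiv_add (dd a z) (dd b z)]
    simp; ring
  have dsmul : ∀ (c : ℂ) (a : W) z, dbar ((c • a : W) : ℂ → ℂ) z = c * dbar a z := by
    intro c a z
    simp only [dbar, Submodule.coe_smul]
    rw [fderiv_const_smul (dd a z)]
    simp; ring
  let A : W →ₗ[ℂ] Lp ℂ 2 (volume : Measure ℂ) :=
    { toFun := fun β => (hmem β).toLp _
      map_add' := fun a b => by
        rw [← MemLp.toLp_add]
        congr 1; ext z; simp only [Pi.add_apply, dadd]; ring
      map_smul' := fun c a => by
        rw [RingHom.id_apply, ← MemLp.toLp_const_smul]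
        congr 1; ext z; simp only [Pi.smul_apply, dsmul, smul_eq_mul]; ring }
  have hinteg : ∀ β : W, Integrable (fun z => f z * (β : ℂ → ℂ) z) := fun β =>
    (hf.mul (c1 β).continuous).integrable_of_hasCompactSupport β.2.2.mul_left
  let l : W →ₗ[ℂ] ℂ :=
    { toFun := fun β => ∫ z, f z * (β : ℂ → ℂ) z
      map_add' := fun a b => by
        rw [← integral_add (hinteg a) (hinteg b)]
        simp [mul_add]
      map_smul' := fun c a => by
        rw [RingHom.id_apply, smul_eq_mul, ← integral_const_mul]
        congr 1; ext z; simp; ring }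
  have hnorm : ∀ β : W, ‖A β‖ = √(∫ z, ‖dbar β z‖ ^ 2 * Real.exp (ψ z)) := by
    intro β
    have h1 : ‖A β‖ ^ 2 = ∫ z, ‖dbar β z‖ ^ 2 * Real.exp (ψ z) := by
      rw [← inner_self_eq_norm_sq (𝕜 := ℂ), L2.inner_def, ← integral_re (L2.integrable_inner _ _)]
      refine integral_congr_ae ?_
      filter_upwards [(hmem β).coeFn_toLp] with z hz
      have : (A β) z = dbar β z * w z := hz
      rw [this, inner_self_eq_norm_sq, norm_mul, mul_pow, hw]
      simp only [Complex.norm_real, Real.norm_eq_abs, Real.abs_exp]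
      rw [← Real.exp_nat_mul]
      congr 2; push_cast; ring
    rw [← h1, Real.sqrt_sq (norm_nonneg _)]
  obtain ⟨y, hy⟩ := exists_inner_eq_of_norm_le A l C fun β => by
    rw [hnorm]; exact hC β β.2.1 β.2.2
  have hyl : LocallyIntegrable (fun z => (starRingEnd ℂ) (y z)) := by
    have hym : MemLp (fun z => (starRingEnd ℂ) (y z)) 2 (volume : Measure ℂ) := (Lp.memLp y).star
    exact hym.locallyIntegrable (by norm_num)
  refine ⟨fun z => (starRingEnd ℂ) (y z) * w z, ?_, ?_, ?_⟩
  · rw [← locallyIntegrableOn_univ] at hyl ⊢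
    exact hyl.mul_continuousOn wc.continuousOn isOpen_univ.isLocallyClosed
  · have := (Lp.memLp y).integrable_norm_pow (by norm_num)
    refine this.congr (Eventually.of_forall fun z => ?_)
    simp only [hw, norm_mul, mul_pow, RCLike.norm_conj, Complex.norm_real, Real.norm_eq_abs,
      Real.abs_exp]
    have h0 : ((2 : ℕ) : ℝ) * (ψ z / 2) + -ψ z = 0 := by push_cast; ring
    rw [← Real.exp_nat_mul, mul_assoc, ← Real.exp_add, h0, Real.exp_zero, mul_one]
  · intro β hβ hβc
    have := hy ⟨β, hβ, hβc⟩
    rw [L2.inner_def] at this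
    change _ = ∫ z, f z * β z at this
    rw [← this]
    refine integral_congr_ae ?_
    filter_upwards [(hmem ⟨β, hβ, hβc⟩).coeFn_toLp] with z hz
    have h2 : (A ⟨β, hβ, hβc⟩) z = dbar β z * w z := hz
    rw [h2, RCLike.inner_apply]
    ring

/-- A concave `C²` function on the line equal to `log` on `[1, ∞)` and quadratic before. -/
noncomputable def logCap (s : ℝ) : ℝ := if s < 1 then -3 / 2 + 2 * s - s ^ 2 / 2 else Real.log s

/-- The derivative of `logCap`. -/
noncomputable def logCapDeriv (s : ℝ) : ℝ := if s < 1 then 2 - s else s⁻¹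

/-- The second derivative of `logCap`. -/
noncomputable def logCapDerivTwo (s : ℝ) : ℝ := if s < 1 then -1 else -(s ^ 2)⁻¹

theorem hasDerivAt_ite_lt_one {f g f' g' : ℝ → ℝ} (hf : ∀ s ≤ 1, HasDerivAt f (f' s) s)
    (hg : ∀ s, 1 ≤ s → HasDerivAt g (g' s) s) (h0 : f 1 = g 1) (h1 : f' 1 = g' 1) (s : ℝ) :
    HasDerivAt (fun t => if t < 1 then f t else g t) (if s < 1 then f' s else g' s) s := by
  rcases lt_trichotomy s 1 with hs | rfl | hs
  · rw [if_pos hs]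
    refine (hf s hs.le).congr_of_eventuallyEq ?_
    filter_upwards [eventually_lt_nhds hs] with t ht
    rw [if_pos ht]
  · rw [if_neg (lt_irrefl _), ← hasDerivWithinAt_univ, ← Iic_union_Ici (a := (1 : ℝ))]
    refine HasDerivWithinAt.union ?_ ?_
    · rw [← h1]
      refine (hf 1 le_rfl).hasDerivWithinAt.congr (fun t ht => ?_) (by simp [h0])
      rcases (mem_Iic.1 ht).lt_or_eq with h | rfl
      · rw [if_pos h]
      · simp [h0]
    · refine (hg 1 le_rfl).hasDerivWithinAt.congr (fun t ht => ?_) (by simp)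
      rw [if_neg (not_lt.2 ht)]
  · rw [if_neg hs.not_gt]
    refine (hg s hs.le).congr_of_eventuallyEq ?_
    filter_upwards [eventually_gt_nhds hs] with t ht
    rw [if_neg ht.not_gt]

theorem hasDerivAt_logCap (s : ℝ) : HasDerivAt logCap (logCapDeriv s) s := by
  refine hasDerivAt_ite_lt_one (f := fun s => -3 / 2 + 2 * s - s ^ 2 / 2) (g := Real.log)
    (f' := fun s => 2 - s) (g' := fun s => s⁻¹) (fun s _ => ?_) (fun s hs => ?_)
    (by norm_num) (by norm_num) s
  · have h := (((hasDerivAt_id s).const_mul 2).const_add (-3 / 2)).sub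
      ((hasDerivAt_pow 2 s).div_const 2)
    refine h.congr_deriv ?_
    norm_num
  · exact Real.hasDerivAt_log (by positivity)

theorem hasDerivAt_logCapDeriv (s : ℝ) : HasDerivAt logCapDeriv (logCapDerivTwo s) s := by
  refine hasDerivAt_ite_lt_one (f := fun s => 2 - s) (g := fun s => s⁻¹)
    (f' := fun _ => -1) (g' := fun s => -(s ^ 2)⁻¹) (fun s _ => ?_) (fun s hs => ?_)
    (by norm_num) (by norm_num) s
  · simpa using (hasDerivAt_id s).const_sub 2
  · exact hasDerivAt_inv (by positivity)

theorem continuous_logCapDerivTwo : Continuous logCapDerivTwo := by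
  have : logCapDerivTwo = fun s => -((max s 1) ^ 2)⁻¹ := by
    ext s
    unfold logCapDerivTwo
    split_ifs with h
    · rw [max_eq_right h.le]; norm_num
    · rw [max_eq_left (not_lt.1 h)]
  rw [this]
  refine Continuous.neg (Continuous.inv₀ (by fun_prop) fun s => ?_)
  have : 1 ≤ max s 1 := le_max_right _ _
  positivity

theorem contDiff_logCapDeriv : ContDiff ℝ 1 logCapDeriv := by
  rw [contDiff_one_iff_deriv]
  refine ⟨fun s => (hasDerivAt_logCapDeriv s).differentiableAt, ?_⟩
  rw [show deriv logCapDeriv = logCapDerivTwo from funext fun s => (hasDerivAt_logCapDeriv s).deriv]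
  exact continuous_logCapDerivTwo

theorem contDiff_logCap : ContDiff ℝ 2 logCap := by
  rw [show (2 : WithTop ℕ∞) = 1 + 1 by norm_num, contDiff_succ_iff_deriv]
  refine ⟨fun s => (hasDerivAt_logCap s).differentiableAt, by simp, ?_⟩
  rw [show deriv logCap = logCapDeriv from funext fun s => (hasDerivAt_logCap s).deriv]
  exact contDiff_logCapDeriv

theorem log_one_add_le_logCap {s : ℝ} (hs : 0 ≤ s) : Real.log (1 + s) - 5 / 2 ≤ logCap s := by
  unfold logCap
  split_ifs with h
  · have := Real.log_le_sub_one_of_pos (show 0 < 1 + s by positivity)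
    nlinarith
  · have h1 : 1 ≤ s := not_lt.1 h
    have h2 : Real.log (1 + s) ≤ Real.log (2 * s) :=
      Real.log_le_log (by positivity) (by linarith)
    rw [Real.log_mul (by norm_num) (by positivity)] at h2
    have := Real.log_two_lt_d9
    linarith

/-- A smoothed `log (|z - a|² / r²)`, unchanged off the disc of radius `r` about `a`. -/
noncomputable def radialLog (a : ℂ) (r : ℝ) (z : ℂ) : ℝ := logCap (Complex.normSq (z - a) / r ^ 2)

theorem contDiff_normSq_sub (a : ℂ) (r : ℝ) {n : WithTop ℕ∞} :
    ContDiff ℝ n fun z : ℂ => Complex.normSq (z - a) / r ^ 2 := by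
  have h : ContDiff ℝ n fun z : ℂ => ‖z - a‖ ^ 2 / r ^ 2 :=
    ((contDiff_id.sub contDiff_const).norm_sq ℝ).div_const _
  simpa only [Complex.normSq_eq_norm_sq] using h

theorem contDiff_radialLog (a : ℂ) (r : ℝ) : ContDiff ℝ 2 (radialLog a r) :=
  contDiff_logCap.comp (contDiff_normSq_sub a r)

theorem fderiv_normSq_sub (a : ℂ) (r : ℝ) (z e : ℂ) :
    fderiv ℝ (fun z : ℂ => Complex.normSq (z - a) / r ^ 2) z e
      = 2 * ((z - a).re * e.re + (z - a).im * e.im) / r ^ 2 := by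
  have h1 : HasFDerivAt (fun z : ℂ => (z - a).re) Complex.reCLM z :=
    Complex.reCLM.hasFDerivAt.comp z ((hasFDerivAt_id z).sub_const a)
  have h2 : HasFDerivAt (fun z : ℂ => (z - a).im) Complex.imCLM z :=
    Complex.imCLM.hasFDerivAt.comp z ((hasFDerivAt_id z).sub_const a)
  have h := (((h1.mul h1).add (h2.mul h2)).mul_const ((r ^ 2)⁻¹)).fderiv
  have e1 : (fun z : ℂ => Complex.normSq (z - a) / r ^ 2)
      = fun z : ℂ => ((z - a).re * (z - a).re + (z - a).im * (z - a).im) / r ^ 2 := by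
    ext z; rw [Complex.normSq_apply]
  rw [e1]
  refine (congrArg (fun L : ℂ →L[ℝ] ℝ => L e) h).trans ?_
  simp
  ring

theorem fderiv_radialLog (a : ℂ) (r : ℝ) (z e : ℂ) :
    fderiv ℝ (radialLog a r) z e = logCapDeriv (Complex.normSq (z - a) / r ^ 2)
      * (2 * ((z - a).re * e.re + (z - a).im * e.im) / r ^ 2) := by
  have h := (hasDerivAt_logCap (Complex.normSq (z - a) / r ^ 2)).comp_hasFDerivAt z
    ((contDiff_normSq_sub a r (n := 1)).differentiable one_ne_zero z).hasFDerivAt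
  have h' : fderiv ℝ (radialLog a r) z = _ := h.fderiv
  rw [h', ← fderiv_normSq_sub]
  simp

theorem fderiv_fderiv_radialLog (a : ℂ) (r : ℝ) (z e : ℂ) :
    fderiv ℝ (fun w => fderiv ℝ (radialLog a r) w e) z e
      = logCapDerivTwo (Complex.normSq (z - a) / r ^ 2)
          * (2 * ((z - a).re * e.re + (z - a).im * e.im) / r ^ 2) ^ 2
        + logCapDeriv (Complex.normSq (z - a) / r ^ 2) * (2 * (e.re * e.re + e.im * e.im) / r ^ 2) := by
  have h := (hasDerivAt_logCapDeriv (Complex.normSq (z - a) / r ^ 2)).comp_hasFDerivAt z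
    ((contDiff_normSq_sub a r (n := 1)).differentiable one_ne_zero z).hasFDerivAt
  have h1 : HasFDerivAt (fun z : ℂ => (z - a).re) Complex.reCLM z :=
    Complex.reCLM.hasFDerivAt.comp z ((hasFDerivAt_id z).sub_const a)
  have h2 : HasFDerivAt (fun z : ℂ => (z - a).im) Complex.imCLM z :=
    Complex.imCLM.hasFDerivAt.comp z ((hasFDerivAt_id z).sub_const a)
  have h3 := (((h1.mul_const e.re).add (h2.mul_const e.im)).const_mul 2).mul_const ((r ^ 2)⁻¹)
  have h4 := (h.mul h3).fderiv
  have e1 : (fun w => fderiv ℝ (radialLog a r) w e) = _ := funext fun w => fderiv_radialLog a r w e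
  rw [e1]
  refine (congrArg (fun L : ℂ →L[ℝ] ℝ => L e) h4).trans ?_
  have h5 := fderiv_normSq_sub a r z e
  simp [h5]
  ring

theorem lap_radialLog {a : ℂ} {r : ℝ} (hr : 0 < r) (z : ℂ) :
    lap (radialLog a r) z = if Complex.normSq (z - a) / r ^ 2 < 1 then
      8 / r ^ 2 * (1 - Complex.normSq (z - a) / r ^ 2) else 0 := by
  have h1 := fderiv_fderiv_radialLog a r z 1
  have h2 := fderiv_fderiv_radialLog a r z Complex.I
  have h : lap (radialLog a r) z = fderiv ℝ (fun w => fderiv ℝ (radialLog a r) w 1) z 1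
    + fderiv ℝ (fun w => fderiv ℝ (radialLog a r) w Complex.I) z Complex.I := rfl
  rw [h, h1, h2]
  set s := Complex.normSq (z - a) / r ^ 2 with hs
  have hs' : (z - a).re ^ 2 + (z - a).im ^ 2 = s * r ^ 2 := by
    rw [hs, div_mul_cancel₀ _ (by positivity), Complex.normSq_apply]; ring
  have : logCapDerivTwo s * (2 * ((z - a).re * (1 : ℂ).re + (z - a).im * (1 : ℂ).im) / r ^ 2) ^ 2
      + logCapDeriv s * (2 * ((1 : ℂ).re * (1 : ℂ).re + (1 : ℂ).im * (1 : ℂ).im) / r ^ 2)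
      + (logCapDerivTwo s * (2 * ((z - a).re * Complex.I.re + (z - a).im * Complex.I.im) / r ^ 2) ^ 2
      + logCapDeriv s * (2 * (Complex.I.re * Complex.I.re + Complex.I.im * Complex.I.im) / r ^ 2))
      = 4 / r ^ 2 * (s * logCapDerivTwo s + logCapDeriv s) := by
    simp only [Complex.one_re, Complex.one_im, Complex.I_re, Complex.I_im]
    field_simp
    linear_combination 4 * logCapDerivTwo s * hs'
  rw [this]
  unfold logCapDeriv logCapDerivTwo
  split_ifs with hlt
  · ring
  · have : 0 < s := lt_of_lt_of_le one_pos (not_lt.1 hlt)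
    field_simp
    ring

/-- `∂ₓ - i ∂ᵧ` applied to `radialLog`: a `C¹` function equal to `2 / (z - a)` off a disc. -/
noncomputable def cauchyCap (a : ℂ) (r : ℝ) (z : ℂ) : ℂ :=
  (fderiv ℝ (radialLog a r) z 1 : ℂ) - Complex.I * (fderiv ℝ (radialLog a r) z Complex.I : ℂ)

theorem contDiff_cauchyCap (a : ℂ) (r : ℝ) : ContDiff ℝ 1 (cauchyCap a r) := by
  have h := fun e => Complex.ofRealCLM.contDiff.comp
    (contDiff_fderiv_apply (contDiff_radialLog a r) e)
  exact (h 1).sub (contDiff_const.mul (h Complex.I))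

theorem dbar_cauchyCap (a : ℂ) (r : ℝ) (z : ℂ) : dbar (cauchyCap a r) z = lap (radialLog a r) z := by
  have h := fun e => ((contDiff_fderiv_apply (contDiff_radialLog a r) e).differentiable
    one_ne_zero z).hasFDerivAt
  have h' := fun e => (Complex.ofRealCLM.hasFDerivAt (x := fderiv ℝ (radialLog a r) z e)).comp z (h e)
  have h3 : fderiv ℝ (cauchyCap a r) z = _ := ((h' 1).sub ((h' Complex.I).const_mul Complex.I)).fderiv
  have sym := fderiv_apply_fderiv_comm (contDiff_radialLog a r) z 1 Complex.I
  have hl : lap (radialLog a r) z = fderiv ℝ (fun w => fderiv ℝ (radialLog a r) w 1) z 1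
    + fderiv ℝ (fun w => fderiv ℝ (radialLog a r) w Complex.I) z Complex.I := rfl
  rw [dbar, h3, hl]
  simp [sym]
  ring_nf
  simp only [Complex.I_sq]
  ring

theorem sub_mul_cauchyCap {a z : ℂ} {r : ℝ} (hr : 0 < r) (hz : r ≤ ‖z - a‖) :
    (z - a) * cauchyCap a r z = 2 := by
  have h1 : ¬ Complex.normSq (z - a) / r ^ 2 < 1 := by
    rw [not_lt, one_le_div (by positivity), Complex.normSq_eq_norm_sq]
    gcongr
  have h2 : (z - a) * (starRingEnd ℂ) (z - a) = Complex.normSq (z - a) := Complex.mul_conj _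
  have h3 : (Complex.normSq (z - a) : ℂ) ≠ 0 := by
    rw [Complex.ofReal_ne_zero, Complex.normSq_eq_norm_sq]
    have : 0 < ‖z - a‖ := hr.trans_le hz
    positivity
  have h4 : (starRingEnd ℂ) (z - a) = (z - a).re - Complex.I * (z - a).im := by
    apply Complex.ext
    · simp
    · simp; ring
  rw [cauchyCap, fderiv_radialLog, fderiv_radialLog, logCapDeriv, if_neg h1]
  have hr' : (r : ℂ) ≠ 0 := by exact_mod_cast hr.ne'
  rw [h4] at h2
  simp only [Complex.one_re, Complex.one_im, Complex.I_re, Complex.I_im]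
  push_cast
  field_simp
  linear_combination h2

/-- A continuous density of infinite mass admits finitely many disjoint discs whose total mass is
large and on each of which the density is comparable to a constant. -/
theorem exists_disjoint_closedBalls_of_lintegral_eq_top {h : ℂ → ℝ} (hc : Continuous h)
    (ht : ∫⁻ z, ENNReal.ofReal (h z) = ⊤) (K : ℝ) :
    ∃ (s : Finset ℂ) (r c : ℂ → ℝ),
      (∀ a ∈ s, 0 < r a ∧ 0 < c a ∧ ∀ z ∈ Metric.closedBall a (r a), 2 * c a ≤ h z) ∧
      (s : Set ℂ).PairwiseDisjoint (fun a => Metric.closedBall a (r a)) ∧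
      K ≤ ∑ a ∈ s, c a * r a ^ 2 := by
  have hr : ∀ z, ∃ ρ : ℝ, 0 < h z → 0 < ρ ∧ ρ ≤ 1 ∧
      ∀ w ∈ Metric.closedBall z (5 * ρ), |h w - h z| ≤ h z / 2 := by
    intro z
    by_cases hz : 0 < h z
    · obtain ⟨δ, δ0, hδ⟩ := Metric.continuous_iff.1 hc z (h z / 2) (by positivity)
      refine ⟨min 1 (δ / 10), fun _ => ⟨by positivity, min_le_left _ _, fun w hw => ?_⟩⟩
      have : dist w z < δ := by
        have h1 := min_le_right 1 (δ / 10)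
        have h2 := Metric.mem_closedBall.1 hw
        linarith
      exact (hδ w this).le
    · exact ⟨0, fun h => absurd h hz⟩
  choose r hr using hr
  obtain ⟨u, hut, hud, hcov⟩ := Vitali.exists_disjoint_subfamily_covering_enlargement_closedBall
    {z | 0 < h z} id r 1 (fun z hz => (hr z hz).2.1) 5 (by norm_num)
  have hu : u.Countable := hud.countable_of_nonempty_interior fun a ha =>
    ⟨a, Metric.ball_subset_interior_closedBall (Metric.mem_ball_self (hr a (hut ha)).1)⟩
  have := hu.to_subtype
  have hsum : ∑' b : u, ENNReal.ofReal (h b / 4 * r b ^ 2) = ⊤ := by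
    by_contra hne
    have hle : ∫⁻ z, ENNReal.ofReal (h z)
        ≤ ENNReal.ofReal (150 * Real.pi) * ∑' b : u, ENNReal.ofReal (h b / 4 * r b ^ 2) := by
      calc ∫⁻ z, ENNReal.ofReal (h z)
          = ∫⁻ z in {z | 0 < h z}, ENNReal.ofReal (h z) := by
            rw [← lintegral_indicator (measurableSet_lt measurable_const hc.measurable)]
            refine lintegral_congr fun z => ?_
            by_cases hz : 0 < h z
            · simp [indicator, hz]
            · simp [indicator, hz, ENNReal.ofReal_eq_zero.2 (not_lt.1 hz)]
        _ ≤ ∫⁻ z in ⋃ b : u, Metric.closedBall (b : ℂ) (5 * r b), ENNReal.ofReal (h z) := by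
            refine lintegral_mono_set fun z hz => ?_
            obtain ⟨b, hb, hzb⟩ := hcov z hz
            exact mem_iUnion.2 ⟨⟨b, hb⟩, hzb (Metric.mem_closedBall_self (hr z hz).1.le)⟩
        _ ≤ ∑' b : u, ∫⁻ z in Metric.closedBall (b : ℂ) (5 * r b), ENNReal.ofReal (h z) :=
            lintegral_iUnion_le _ _
        _ ≤ ∑' b : u, ENNReal.ofReal (150 * Real.pi) * ENNReal.ofReal (h b / 4 * r b ^ 2) := by
            refine ENNReal.tsum_le_tsum fun b => ?_
            obtain ⟨h1, h2, h3⟩ := hr b (hut b.2)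
            have hb : 0 < h b := hut b.2
            calc ∫⁻ z in Metric.closedBall (b : ℂ) (5 * r b), ENNReal.ofReal (h z)
                ≤ ∫⁻ z in Metric.closedBall (b : ℂ) (5 * r b), ENNReal.ofReal (3 / 2 * h b) := by
                  refine setLIntegral_mono measurable_const fun z hz => ?_
                  refine ENNReal.ofReal_le_ofReal ?_
                  have := (abs_le.1 (h3 z hz)).2
                  linarith
              _ = ENNReal.ofReal (150 * Real.pi) * ENNReal.ofReal (h b / 4 * r b ^ 2) := by
                  rw [setLIntegral_const, Complex.volume_closedBall,
                    ← ENNReal.ofReal_pow (by positivity), ← ENNReal.ofReal_mul (by positivity),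
                    ← ENNReal.ofReal_coe_nnreal, ← ENNReal.ofReal_mul (by positivity),
                    ← ENNReal.ofReal_mul (by positivity)]
                  congr 1
                  rw [NNReal.coe_real_pi]
                  ring
        _ = _ := ENNReal.tsum_mul_left
    rw [ht, top_le_iff] at hle
    exact ENNReal.mul_ne_top ENNReal.ofReal_ne_top hne hle
  rw [ENNReal.tsum_eq_iSup_sum, iSup_eq_top] at hsum
  obtain ⟨s, hs⟩ := hsum (ENNReal.ofReal K) ENNReal.ofReal_lt_top
  have hmem : ∀ a ∈ s.map (Function.Embedding.subtype (· ∈ u)), a ∈ u := by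
    intro a ha
    obtain ⟨b, -, rfl⟩ := Finset.mem_map.1 ha
    exact b.2
  refine ⟨s.map (Function.Embedding.subtype (· ∈ u)), r, fun a => h a / 4, fun a ha => ?_, ?_, ?_⟩
  · have hau := hmem a ha
    have h0 : 0 < h a := hut hau
    obtain ⟨h1, h2, h3⟩ := hr a h0
    refine ⟨h1, by positivity, fun z hz => ?_⟩
    have := (abs_le.1 (h3 z (Metric.closedBall_subset_closedBall (by linarith) hz))).1
    linarith
  · exact hud.subset fun a ha => hmem a ha
  · rw [Finset.sum_map]
    rw [← ENNReal.ofReal_sum_of_nonneg fun b _ => by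
      have : 0 < h b := hut b.2
      positivity] at hs
    exact (ENNReal.ofReal_lt_ofReal_iff'.1 hs).1.le

theorem lap_radialLog_le {a : ℂ} {r : ℝ} (hr : 0 < r) (z : ℂ) :
    lap (radialLog a r) z ≤ 8 / r ^ 2 := by
  rw [lap_radialLog hr]
  split_ifs with h
  · have : 0 ≤ Complex.normSq (z - a) / r ^ 2 := div_nonneg (Complex.normSq_nonneg _) (by positivity)
    exact mul_le_of_le_one_right (by positivity) (by linarith)
  · positivity

theorem lap_radialLog_eq_zero {a : ℂ} {r : ℝ} (hr : 0 < r) {z : ℂ}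
    (hz : z ∉ Metric.closedBall a r) : lap (radialLog a r) z = 0 := by
  rw [lap_radialLog hr, if_neg]
  rw [Metric.mem_closedBall, not_le, dist_eq_norm] at hz
  rw [not_lt, one_le_div (by positivity), Complex.normSq_eq_norm_sq]
  gcongr

theorem exists_le_radialLog (a b : ℂ) {r : ℝ} (hr : 0 < r) :
    ∃ C : ℝ, ∀ z, Real.log (1 + ‖z - a‖ ^ 2) - C ≤ radialLog b r z := by
  set A : ℝ := 1 + 2 * r ^ 2 + 2 * ‖b - a‖ ^ 2 with hA
  refine ⟨Real.log A + 5 / 2, fun z => ?_⟩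
  have h := log_one_add_le_logCap (s := Complex.normSq (z - b) / r ^ 2)
    (div_nonneg (Complex.normSq_nonneg _) (by positivity))
  have h1 : 1 + ‖z - a‖ ^ 2 ≤ A * (1 + Complex.normSq (z - b) / r ^ 2) := by
    have h2 : ‖z - a‖ ≤ ‖z - b‖ + ‖b - a‖ := norm_sub_le_norm_sub_add_norm_sub z b a
    have h3 : Complex.normSq (z - b) = Complex.normSq (z - b) / r ^ 2 * r ^ 2 := by field_simp
    have h4 : 0 ≤ Complex.normSq (z - b) / r ^ 2 :=
      div_nonneg (Complex.normSq_nonneg _) (by positivity)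
    rw [Complex.normSq_eq_norm_sq] at *
    set s := ‖z - b‖ ^ 2 / r ^ 2
    have h5 : ‖z - a‖ ^ 2 ≤ 2 * ‖z - b‖ ^ 2 + 2 * ‖b - a‖ ^ 2 := by
      nlinarith [norm_nonneg (z - a), norm_nonneg (z - b), norm_nonneg (b - a),
        sq_nonneg (‖z - b‖ - ‖b - a‖)]
    have h6 : 0 ≤ s * ‖b - a‖ ^ 2 := by positivity
    rw [hA]
    nlinarith [sq_nonneg r]
  have h7 := Real.log_le_log (by positivity) h1
  rw [Real.log_mul (by positivity) (by
    have : 0 ≤ Complex.normSq (z - b) / r ^ 2 :=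
      div_nonneg (Complex.normSq_nonneg _) (by positivity)
    positivity)] at h7
  unfold radialLog
  linarith

theorem lap_sub_const_mul {φ L : ℂ → ℝ} (hφ : ContDiff ℝ 2 φ) (hL : ContDiff ℝ 2 L) (k : ℝ)
    (z : ℂ) : lap (fun w => φ w - k * L w) z = lap φ z - k * lap L z := by
  have h1 : ∀ e : ℂ, (fun w => fderiv ℝ (fun w => φ w - k * L w) w e)
      = fun w => fderiv ℝ φ w e - k * fderiv ℝ L w e := by
    intro e
    ext w
    rw [fderiv_fun_sub (hφ.differentiable two_ne_zero w)
      ((hL.differentiable two_ne_zero w).const_mul k),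
      fderiv_const_mul (hL.differentiable two_ne_zero w)]
    simp
  have h2 : ∀ e : ℂ, fderiv ℝ (fun w => fderiv ℝ (fun w => φ w - k * L w) w e) z e
      = fderiv ℝ (fun w => fderiv ℝ φ w e) z e - k * fderiv ℝ (fun w => fderiv ℝ L w e) z e := by
    intro e
    have d1 := (contDiff_fderiv_apply hφ e).differentiable one_ne_zero z
    have d2 := (contDiff_fderiv_apply hL e).differentiable one_ne_zero z
    rw [h1, fderiv_fun_sub d1 (d2.const_mul k), fderiv_const_mul d2]
    simp
  have h3 := h2 1
  have h4 := h2 Complex.I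
  simp only [lap, pdxR, pdyR]
  rw [h3, h4]
  ring

theorem lap_sub_sum {ι : Type*} {φ : ℂ → ℝ} (hφ : ContDiff ℝ 2 φ) {L : ι → ℂ → ℝ}
    (hL : ∀ i, ContDiff ℝ 2 (L i)) (k : ι → ℝ) (s : Finset ι) (z : ℂ) :
    lap (fun w => φ w - ∑ i ∈ s, k i * L i w) z = lap φ z - ∑ i ∈ s, k i * lap (L i) z := by
  classical
  induction s using Finset.induction_on generalizing z with
  | empty => simp
  | insert i s hi ih =>
    have h : (fun w => φ w - ∑ i ∈ insert i s, k i * L i w)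
        = fun w => (φ w - ∑ i ∈ s, k i * L i w) - k i * L i w := by
      ext w; rw [Finset.sum_insert hi]; ring
    rw [h, lap_sub_const_mul (hφ.sub (ContDiff.sum fun i _ => contDiff_const.mul (hL i))) (hL i), ih,
      Finset.sum_insert hi]
    ring

/-- A subharmonic weight of infinite mass can be lowered by a large multiple of
`log (1 + |z - a|²)` while keeping half of its Laplacian. -/
theorem exists_weight_add_log_le {φ : ℂ → ℝ} (hφ : ContDiff ℝ 2 φ) (hsub : ∀ z, 0 ≤ lap φ z)
    (hinf : ∫⁻ z, ENNReal.ofReal (lap φ z) = ⊤) (a : ℂ) (K : ℝ) :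
    ∃ (ψ : ℂ → ℝ) (C : ℝ), ContDiff ℝ 2 ψ ∧ (∀ z, lap φ z / 2 ≤ lap ψ z) ∧
      ∀ z, K * Real.log (1 + ‖z - a‖ ^ 2) - C ≤ φ z - ψ z := by
  obtain ⟨s, r, c, hs, hd, hK⟩ :=
    exists_disjoint_closedBalls_of_lintegral_eq_top (continuous_lap hφ) hinf (8 * K)
  have hC : ∀ b, ∃ C : ℝ, b ∈ s → ∀ z, Real.log (1 + ‖z - a‖ ^ 2) - C ≤ radialLog b (r b) z := by
    intro b
    by_cases hb : b ∈ s
    · obtain ⟨C, hC⟩ := exists_le_radialLog a b (hs b hb).1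
      exact ⟨C, fun _ => hC⟩
    · exact ⟨0, fun h => absurd h hb⟩
  choose C hC using hC
  set k : ℂ → ℝ := fun b => c b * r b ^ 2 / 8 with hk
  have hk0 : ∀ b ∈ s, 0 ≤ k b := fun b hb => by
    have := (hs b hb).2.1
    positivity
  refine ⟨fun z => φ z - ∑ b ∈ s, k b * radialLog b (r b) z, ∑ b ∈ s, k b * C b,
    hφ.sub (ContDiff.sum fun b _ => contDiff_const.mul (contDiff_radialLog b (r b))),
    fun z => ?_, fun z => ?_⟩
  · rw [lap_sub_sum hφ (fun b => contDiff_radialLog b (r b))]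
    suffices h : ∑ b ∈ s, k b * lap (radialLog b (r b)) z ≤ lap φ z / 2 by linarith
    by_cases hz : ∃ b ∈ s, z ∈ Metric.closedBall b (r b)
    · obtain ⟨b, hb, hzb⟩ := hz
      obtain ⟨h1, h2, h3⟩ := hs b hb
      rw [Finset.sum_eq_single b]
      · calc k b * lap (radialLog b (r b)) z ≤ k b * (8 / r b ^ 2) :=
              mul_le_mul_of_nonneg_left (lap_radialLog_le h1 z) (hk0 b hb)
          _ = c b := by rw [hk]; field_simp
          _ ≤ lap φ z / 2 := by linarith [h3 z hzb]
      · intro b' hb' hne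
        rw [lap_radialLog_eq_zero (hs b' hb').1, mul_zero]
        exact fun hz' => disjoint_left.1 (hd hb' hb hne) hz' hzb
      · exact fun h => absurd hb h
    · push Not at hz
      rw [Finset.sum_eq_zero fun b hb => by
        rw [lap_radialLog_eq_zero (hs b hb).1 (hz b hb), mul_zero]]
      linarith [hsub z]
  · have h0 : 0 ≤ Real.log (1 + ‖z - a‖ ^ 2) := Real.log_nonneg (by nlinarith [sq_nonneg ‖z - a‖])
    have h1 : K ≤ ∑ b ∈ s, k b := by
      rw [hk, ← Finset.sum_div]; linarith
    have h2 : ∑ b ∈ s, k b * (Real.log (1 + ‖z - a‖ ^ 2) - C b)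
        ≤ ∑ b ∈ s, k b * radialLog b (r b) z :=
      Finset.sum_le_sum fun b hb => mul_le_mul_of_nonneg_left (hC b hb z) (hk0 b hb)
    simp_rw [mul_sub] at h2
    rw [Finset.sum_sub_distrib, ← Finset.sum_mul] at h2
    have h3 := mul_le_mul_of_nonneg_right h1 h0
    linarith

theorem exists_norm_integral_mul_le {ψ : ℂ → ℝ} (hψ : ContDiff ℝ 2 ψ) (h0 : ∀ z, 0 ≤ lap ψ z)
    {S : Set ℂ} {c : ℝ} (hc : 0 < c) (hS : ∀ z ∈ S, c ≤ lap ψ z) {f : ℂ → ℂ} (hf : Continuous f)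
    (hfc : HasCompactSupport f) (hfS : ∀ z, z ∉ S → f z = 0) :
    ∃ C : ℝ, ∀ β : ℂ → ℂ, ContDiff ℝ ∞ β → HasCompactSupport β →
      ‖∫ z, f z * β z‖ ≤ C * √(∫ z, ‖dbar β z‖ ^ 2 * Real.exp (ψ z)) := by
  have ψc := hψ.continuous
  have lc := continuous_lap hψ
  set P : ℂ → ℝ := fun z => ‖f z‖ * Real.exp (-ψ z / 2) with hP
  refine ⟨(√c)⁻¹ * √(∫ z, P z ^ 2), fun β hβ hβc => ?_⟩
  set Q : ℂ → ℝ := fun z => ‖β z‖ * (√(lap ψ z) * Real.exp (ψ z / 2)) with hQ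
  have cP : Continuous P := by fun_prop
  have cQ : Continuous Q := hβ.continuous.norm.mul (lc.sqrt.mul (by fun_prop))
  have hPc : HasCompactSupport P := hfc.norm.mul_right
  have hQc : HasCompactSupport Q := hβc.norm.mul_right
  have hP0 : ∀ z, 0 ≤ P z := fun z => by positivity
  have hQ0 : ∀ z, 0 ≤ Q z := fun z => by positivity
  have hPQ : ∀ z, ‖f z * β z‖ ≤ (√c)⁻¹ * (P z * Q z) := by
    intro z
    by_cases hz : z ∈ S
    · have h1 : √c ≤ √(lap ψ z) := Real.sqrt_le_sqrt (hS z hz)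
      have h2 : 0 < √c := Real.sqrt_pos.2 hc
      have h3 : Real.exp (-ψ z / 2) * Real.exp (ψ z / 2) = 1 := by
        rw [← Real.exp_add, ← Real.exp_zero]; congr 1; ring
      have h4 : P z * Q z = ‖f z‖ * ‖β z‖ * √(lap ψ z) := by
        simp only [hP, hQ]
        linear_combination (‖f z‖ * ‖β z‖ * √(lap ψ z)) * h3
      rw [norm_mul, h4, inv_mul_eq_div, le_div_iff₀ h2]
      gcongr
    · have := hP0 z
      have := hQ0 z
      rw [hfS z hz, zero_mul, norm_zero]
      positivity
  have hol := integral_mul_le_Lp_mul_Lq_of_nonneg (μ := (volume : Measure ℂ))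
    Real.HolderConjugate.two_two (Eventually.of_forall hP0) (Eventually.of_forall hQ0)
    (cP.memLp_of_hasCompactSupport hPc) (cQ.memLp_of_hasCompactSupport hQc)
  simp only [Real.rpow_two, ← Real.sqrt_eq_rpow] at hol
  have hQ2 : ∫ z, Q z ^ 2 = ∫ z, lap ψ z * ‖β z‖ ^ 2 * Real.exp (ψ z) := by
    refine integral_congr_ae (Eventually.of_forall fun z => ?_)
    have h1 : Real.exp (ψ z / 2) ^ 2 = Real.exp (ψ z) := by
      rw [← Real.exp_nat_mul]; congr 1; push_cast; ring
    simp only [hQ]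
    rw [mul_pow, mul_pow, Real.sq_sqrt (h0 z), h1]
    ring
  have en := integral_lap_mul_le_integral_dbar hψ (contDiff_infty.1 hβ 2) hβc
  calc ‖∫ z, f z * β z‖ ≤ ∫ z, (√c)⁻¹ * (P z * Q z) :=
        norm_integral_le_of_norm_le
          (((cP.mul cQ).integrable_of_hasCompactSupport hPc.mul_right).const_mul _)
          (Eventually.of_forall hPQ)
    _ = (√c)⁻¹ * ∫ z, P z * Q z := integral_const_mul _ _
    _ ≤ (√c)⁻¹ * (√(∫ z, P z ^ 2) * √(∫ z, Q z ^ 2)) := by gcongr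
    _ ≤ (√c)⁻¹ * (√(∫ z, P z ^ 2) * √(∫ z, ‖dbar β z‖ ^ 2 * Real.exp (ψ z))) := by
        rw [hQ2]; gcongr
    _ = _ := by ring

theorem integral_mul_dbar {η β : ℂ → ℂ} (hη : ContDiff ℝ 1 η) (hβ : ContDiff ℝ 1 β)
    (hc : HasCompactSupport β) : ∫ z, η z * dbar β z = -∫ z, dbar η z * β z := by
  have hm : ContDiff ℝ 1 fun z => η z * β z := hη.mul hβ
  have hmc : HasCompactSupport fun z => η z * β z := hc.mul_left
  have hi : ∀ e : ℂ, Integrable fun z => fderiv ℝ (fun z => η z * β z) z e := fun e =>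
    ((hm.continuous_fderiv one_ne_zero).clm_apply continuous_const).integrable_of_hasCompactSupport
      ((hmc.fderiv ℝ).comp_left (g := fun L : ℂ →L[ℝ] ℂ => L e) (by simp))
  have h0 : ∫ z, dbar (fun z => η z * β z) z = 0 := by
    simp only [dbar]
    rw [integral_add (hi 1) ((hi Complex.I).const_mul _), integral_const_mul,
      integral_fderiv_apply_eq_zero hm hmc, integral_fderiv_apply_eq_zero hm hmc]
    simp
  have h1 : ∀ z, dbar (fun z => η z * β z) z = η z * dbar β z + dbar η z * β z := by
    intro z
    simp only [dbar]
    rw [fderiv_fun_mul (hη.differentiable one_ne_zero z) (hβ.differentiable one_ne_zero z)]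
    simp
    ring
  have i1 : Integrable fun z => η z * dbar β z :=
    (hη.continuous.mul (continuous_dbar hβ)).integrable_of_hasCompactSupport hc.dbar.mul_left
  have i2 : Integrable fun z => dbar η z * β z :=
    ((continuous_dbar hη).mul hβ.continuous).integrable_of_hasCompactSupport hc.mul_left
  simp_rw [h1] at h0
  rw [integral_add i1 i2] at h0
  exact eq_neg_of_add_eq_zero_left h0

/-- An entire function not vanishing at `a` which, off a disc about `a`, is `z - a` times an element
of `L²(e^{-ψ})`. -/
theorem exists_entire_ae_eq_sub_mul {ψ : ℂ → ℝ} (hψ : ContDiff ℝ 2 ψ) (h0 : ∀ z, 0 ≤ lap ψ z)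
    {a : ℂ} (ha : 0 < lap ψ a) :
    ∃ (F v : ℂ → ℂ) (r : ℝ), Differentiable ℂ F ∧ F a ≠ 0 ∧
      Integrable (fun z => ‖v z‖ ^ 2 * Real.exp (-ψ z)) ∧
      ∀ᵐ z, r ≤ ‖z - a‖ → F z = (z - a) * v z := by
  obtain ⟨r, hr, hrS⟩ : ∃ r > 0, ∀ z ∈ Metric.closedBall a r, lap ψ a / 2 ≤ lap ψ z := by
    obtain ⟨δ, δ0, hδ⟩ := Metric.continuous_iff.1 (continuous_lap hψ) a (lap ψ a / 2) (by positivity)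
    refine ⟨δ / 2, by positivity, fun z hz => ?_⟩
    have h1 := hδ z (by have := Metric.mem_closedBall.1 hz; linarith)
    rw [Real.dist_eq] at h1
    linarith [(abs_lt.1 h1).1]
  have hη := contDiff_cauchyCap a r
  have hfS : ∀ z, z ∉ Metric.closedBall a r → dbar (cauchyCap a r) z = 0 := fun z hz => by
    rw [dbar_cauchyCap, lap_radialLog_eq_zero hr hz, Complex.ofReal_zero]
  have hfc : HasCompactSupport (dbar (cauchyCap a r)) :=
    HasCompactSupport.intro (isCompact_closedBall a r) fun z hz => hfS z hz
  obtain ⟨C, hC⟩ := exists_norm_integral_mul_le hψ h0 (half_pos ha) hrS (continuous_dbar hη) hfc hfS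
  obtain ⟨v, hvl, hvi, hv⟩ :=
    exists_weak_dbar_solution hψ.continuous (continuous_dbar hη) C hC
  obtain ⟨h, hh, hvh⟩ := exists_entire_ae_eq_of_weakly_holomorphic
    (u := fun z => v z + cauchyCap a r z) (hvl.add hη.continuous.locallyIntegrable) (by
      intro β hβ hβc
      have hβ1 : ContDiff ℝ 1 β := hβ.of_le (by exact_mod_cast le_top)
      have i1 : Integrable fun z => v z * dbar β z :=
        hvl.integrable_smul_right_of_hasCompactSupport (continuous_dbar hβ1) hβc.dbar
      have i2 : Integrable fun z => cauchyCap a r z * dbar β z :=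
        (hη.continuous.mul (continuous_dbar hβ1)).integrable_of_hasCompactSupport
          hβc.dbar.mul_left
      simp_rw [add_mul]
      rw [integral_add i1 i2, integral_mul_dbar hη hβ1 hβc, hv β hβ hβc, add_neg_cancel])
  refine ⟨fun z => (z - a) * h z - 2, v, r, by fun_prop, by simp, hvi, ?_⟩
  filter_upwards [hvh] with z hz hrz
  have := sub_mul_cauchyCap hr hrz
  rw [← hz]
  linear_combination this

theorem exists_entire_integrable_pow_mul {φ ψ : ℂ → ℝ} (hφ : Continuous φ) (hψ : ContDiff ℝ 2 ψ)
    (h0 : ∀ z, 0 ≤ lap ψ z) {a : ℂ} (ha : 0 < lap ψ a) {N : ℕ} {C : ℝ}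
    (hC : ∀ z, N * Real.log (1 + ‖z - a‖ ^ 2) - C ≤ φ z - ψ z) :
    ∃ F : ℂ → ℂ, Differentiable ℂ F ∧ F a ≠ 0 ∧
      ∀ k < N, Integrable fun z => ‖(z - a) ^ k * F z‖ ^ 2 * Real.exp (-φ z) := by
  obtain ⟨F, v, r, hF, hFa, hv, hFv⟩ := exists_entire_ae_eq_sub_mul hψ h0 ha
  refine ⟨F, hF, hFa, fun k hk => ?_⟩
  have hFc := hF.continuous
  have cont : Continuous fun z => ‖(z - a) ^ k * F z‖ ^ 2 * Real.exp (-φ z) := by fun_prop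
  rw [← integrableOn_univ, ← union_compl_self (Metric.closedBall a r)]
  refine (cont.continuousOn.integrableOn_compact (isCompact_closedBall a r)).union ?_
  refine Integrable.mono' ((hv.const_mul (Real.exp C)).integrableOn (s := (Metric.closedBall a r)ᶜ))
    cont.aestronglyMeasurable ?_
  filter_upwards [ae_restrict_of_ae hFv, ae_restrict_mem Metric.isClosed_closedBall.measurableSet.compl]
    with z hz hzr
  have hr : r ≤ ‖z - a‖ := by
    rw [mem_compl_iff, Metric.mem_closedBall, not_le, dist_eq_norm] at hzr
    exact hzr.le
  rw [Real.norm_of_nonneg (by positivity), hz hr, ← mul_assoc, ← pow_succ, norm_mul, mul_pow,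
    norm_pow]
  have h1 : (‖z - a‖ ^ (k + 1)) ^ 2 ≤ (1 + ‖z - a‖ ^ 2) ^ N := by
    rw [← pow_mul, mul_comm, pow_mul]
    calc (‖z - a‖ ^ 2) ^ (k + 1) ≤ (1 + ‖z - a‖ ^ 2) ^ (k + 1) := by gcongr; linarith
      _ ≤ (1 + ‖z - a‖ ^ 2) ^ N :=
        pow_le_pow_right₀ (by nlinarith [sq_nonneg ‖z - a‖]) hk
  have h2 : (1 + ‖z - a‖ ^ 2) ^ N = Real.exp (N * Real.log (1 + ‖z - a‖ ^ 2)) := by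
    rw [Real.exp_nat_mul, Real.exp_log (by positivity)]
  calc (‖z - a‖ ^ (k + 1)) ^ 2 * ‖v z‖ ^ 2 * Real.exp (-φ z)
      ≤ Real.exp (N * Real.log (1 + ‖z - a‖ ^ 2)) * ‖v z‖ ^ 2 * Real.exp (-φ z) := by
        rw [← h2]; gcongr
    _ = ‖v z‖ ^ 2 * Real.exp (N * Real.log (1 + ‖z - a‖ ^ 2) + -φ z) := by
        rw [Real.exp_add]; ring
    _ ≤ ‖v z‖ ^ 2 * Real.exp (C + -ψ z) := by
        gcongr ?_ * Real.exp ?_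
        linarith [hC z]
    _ = Real.exp C * (‖v z‖ ^ 2 * Real.exp (-ψ z)) := by rw [Real.exp_add]; ring

theorem linearIndependent_sub_pow_mul {F : ℂ → ℂ} (hF : Continuous F) {a : ℂ} (ha : F a ≠ 0)
    (N : ℕ) : LinearIndependent ℂ fun (k : Fin N) (z : ℂ) => (z - a) ^ (k : ℕ) * F z := by
  rw [Fintype.linearIndependent_iff]
  intro c hc
  set p : Polynomial ℂ := ∑ k : Fin N, Polynomial.monomial (k : ℕ) (c k) with hp
  have hp0 : p = 0 := by
    refine Polynomial.eq_zero_of_infinite_isRoot p ?_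
    have hev : ∀ᶠ w : ℂ in 𝓝 0, F (w + a) ≠ 0 := by
      have hcont : ContinuousAt (fun w => F (w + a)) 0 := by fun_prop
      exact hcont.eventually_ne (by simpa using ha)
    refine (infinite_of_mem_nhds (0 : ℂ) hev).mono fun w hw => ?_
    have := congrFun hc (w + a)
    simp only [Finset.sum_apply, Pi.smul_apply, smul_eq_mul, add_sub_cancel_right, Pi.zero_apply,
      ← mul_assoc, ← Finset.sum_mul] at this
    rw [mem_ofPred_eq, Polynomial.IsRoot, hp, Polynomial.eval_finsetSum]
    simpa using (mul_eq_zero.1 this).resolve_right hw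
  intro k
  have h := congrArg (fun q => Polynomial.coeff q k) hp0
  simpa [hp, Polynomial.finsetSum_coeff, Polynomial.coeff_monomial, Fin.val_inj] using h

/-- The weighted Bergman space of the plane. -/
noncomputable def bergmanSubmodule {φ : ℂ → ℝ} (hφ : Continuous φ) : Submodule ℂ (ℂ → ℂ) where
  carrier := {f | Differentiable ℂ f ∧ Integrable fun z => ‖f z‖ ^ 2 * Real.exp (-φ z)}
  add_mem' := by
    rintro f g ⟨hf, hfi⟩ ⟨hg, hgi⟩
    have hfc := hf.continuous
    have hgc := hg.continuous
    refine ⟨hf.add hg, ((hfi.const_mul 2).add (hgi.const_mul 2)).mono'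
      (((hfc.add hgc).norm.pow 2).mul (Real.continuous_exp.comp hφ.neg)).aestronglyMeasurable
      (Eventually.of_forall fun z => ?_)⟩
    rw [Real.norm_of_nonneg (by positivity)]
    have h1 : ‖f z + g z‖ ^ 2 ≤ 2 * ‖f z‖ ^ 2 + 2 * ‖g z‖ ^ 2 := by
      nlinarith [norm_add_le (f z) (g z), norm_nonneg (f z + g z), norm_nonneg (f z),
        norm_nonneg (g z), sq_nonneg (‖f z‖ - ‖g z‖)]
    have := mul_le_mul_of_nonneg_right h1 (Real.exp_pos (-φ z)).le
    simp only [Pi.add_apply]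
    linarith
  zero_mem' := ⟨differentiable_const 0, by simp⟩
  smul_mem' := by
    rintro c f ⟨hf, hfi⟩
    refine ⟨hf.const_smul c, (hfi.const_mul (‖c‖ ^ 2)).congr (Eventually.of_forall fun z => ?_)⟩
    simp only [Pi.smul_apply, smul_eq_mul, norm_mul, mul_pow]
    ring

theorem exists_linearIndependent_entire {φ : ℂ → ℝ} (hφ : ContDiff ℝ 2 φ) (hsub : ∀ z, 0 ≤ lap φ z)
    (hinf : ∫⁻ z, ENNReal.ofReal (lap φ z) = ⊤) :
    ∃ f : ℕ → ℂ → ℂ, (∀ k, Differentiable ℂ (f k) ∧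
      Integrable fun z => ‖f k z‖ ^ 2 * Real.exp (-φ z)) ∧ LinearIndependent ℂ f := by
  obtain ⟨a, ha⟩ : ∃ a, 0 < lap φ a := by
    by_contra hne
    push Not at hne
    simp [ENNReal.ofReal_eq_zero.2 (hne _)] at hinf
  set V := bergmanSubmodule hφ.continuous with hV
  have hfin : ¬ Module.Finite ℂ V := by
    intro hfd
    set N := Module.finrank ℂ V + 1 with hN
    obtain ⟨ψ, C, hψ, hψφ, hC⟩ := exists_weight_add_log_le hφ hsub hinf a N
    obtain ⟨F, hF, hFa, hFi⟩ := exists_entire_integrable_pow_mul hφ.continuous hψ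
      (fun z => by linarith [hsub z, hψφ z]) (by linarith [hψφ a]) hC
    let e : Fin N → V := fun k => ⟨fun z => (z - a) ^ (k : ℕ) * F z, by fun_prop, hFi k k.2⟩
    have he : LinearIndependent ℂ e :=
      LinearIndependent.of_comp V.subtype (linearIndependent_sub_pow_mul hF.continuous hFa N)
    have := he.fintype_card_le_finrank
    simp at this
    omega
  let b := Module.Basis.ofVectorSpace ℂ V
  have : Infinite (Module.Basis.ofVectorSpaceIndex ℂ V) := by
    by_contra hi
    rw [not_infinite_iff_finite] at hi
    exact hfin (Module.Finite.of_basis b)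
  refine ⟨fun k => (b (Infinite.natEmbedding _ k) : ℂ → ℂ), fun k => (b _).2, ?_⟩
  exact (b.linearIndependent.map' V.subtype V.ker_subtype).comp _ (Infinite.natEmbedding _).injective

/-- A nonzero measure satisfying the doubling inequality has infinite total mass. -/
theorem measure_univ_eq_top_of_doubling {μ : Measure ℂ} (hμ : μ ≠ 0) {C : ℝ}
    (hC : ∀ (z : ℂ) (r : ℝ), 0 < r →
      μ (Metric.ball z r) ≤ ENNReal.ofReal C * μ (Metric.ball z (r / 2))) :
    μ univ = ⊤ := by
  by_contra htop
  have lim : Tendsto (fun n : ℕ => μ (Metric.ball (0 : ℂ) n)) atTop (𝓝 (μ univ)) := by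
    have := tendsto_measure_iUnion_atTop (μ := μ) (s := fun n : ℕ => Metric.ball (0 : ℂ) n)
      (fun a b hab => Metric.ball_subset_ball (by exact_mod_cast hab))
    rwa [Metric.iUnion_ball_nat] at this
  set D := ENNReal.ofReal C with hD
  have key : ∀ r : ℝ, 0 < r → μ (Metric.ball (0 : ℂ) r) ≤ D ^ 3 * (μ univ - μ (Metric.ball 0 r)) := by
    intro r hr
    set w : ℂ := ((3 * r / 2 : ℝ) : ℂ) with hw
    have nw : dist (0 : ℂ) w = 3 * r / 2 := by
      rw [dist_zero_left, hw, Complex.norm_real, Real.norm_of_nonneg (by positivity)]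
    have h1 : Metric.ball (0 : ℂ) r ⊆ Metric.ball w (4 * r) :=
      Metric.ball_subset_ball' (by rw [nw]; linarith)
    have h2 := hC w (4 * r) (by positivity)
    have h3 := hC w (4 * r / 2) (by positivity)
    have h4 := hC w (4 * r / 2 / 2) (by positivity)
    have h5 : Disjoint (Metric.ball w (4 * r / 2 / 2 / 2)) (Metric.ball 0 r) :=
      Metric.ball_disjoint_ball (by rw [dist_comm, nw]; linarith)
    have h6 : μ (Metric.ball w (4 * r / 2 / 2 / 2)) ≤ μ univ - μ (Metric.ball 0 r) := by
      rw [← measure_compl Metric.isOpen_ball.measurableSet (measure_ne_top_of_subset (subset_univ _) htop)]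
      exact measure_mono h5.subset_compl_right
    calc μ (Metric.ball (0 : ℂ) r) ≤ μ (Metric.ball w (4 * r)) := measure_mono h1
      _ ≤ D * (D * (D * μ (Metric.ball w (4 * r / 2 / 2 / 2)))) := by
        refine h2.trans ?_
        gcongr
        refine h3.trans ?_
        gcongr
      _ ≤ D * (D * (D * (μ univ - μ (Metric.ball 0 r)))) := by gcongr
      _ = _ := by ring
  have lim2 : Tendsto (fun n : ℕ => D ^ 3 * (μ univ - μ (Metric.ball (0 : ℂ) n))) atTop (𝓝 0) := by
    have h := ENNReal.Tendsto.sub (tendsto_const_nhds (x := μ univ)) lim (Or.inl htop)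
    have h' := ENNReal.Tendsto.const_mul (a := D ^ 3) h
      (Or.inr (ENNReal.pow_ne_top ENNReal.ofReal_ne_top))
    simpa using h'
  have : μ univ ≤ 0 := by
    refine le_of_tendsto_of_tendsto lim lim2 ?_
    filter_upwards [eventually_gt_atTop 0] with n hn
    exact key n (by exact_mod_cast hn)
  exact hμ (Measure.measure_univ_eq_zero.1 (le_antisymm this bot_le))

theorem exists_linearIndependent_entire_pi {n : ℕ} (hn : 0 < n) {φ : Fin n → ℂ → ℝ}
    {f : Fin n → ℕ → ℂ → ℂ} (hf : ∀ j k, Differentiable ℂ (f j k))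
    (hfi : ∀ j k, Integrable fun z => ‖f j k z‖ ^ 2 * Real.exp (-φ j z))
    (hfl : ∀ j, LinearIndependent ℂ (f j)) :
    ∃ g : ℕ → (Fin n → ℂ) → ℂ,
      (∀ k, Differentiable ℂ (g k) ∧
        Integrable (fun z => ‖g k z‖ ^ 2 * Real.exp (-(∑ j, φ j (z j))))) ∧
      LinearIndependent ℂ g := by
  let i₀ : Fin n := ⟨0, hn⟩
  let m : ℕ → Fin n → ℕ := fun k j => if j = i₀ then k else 0
  refine ⟨fun k z => ∏ j, f j (m k j) (z j), fun k => ⟨?_, ?_⟩, ?_⟩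
  · have h : ∀ j, Differentiable ℂ fun z : Fin n → ℂ => f j (m k j) (z j) := fun j =>
      (hf j (m k j)).comp (differentiable_pi.1 differentiable_id j)
    fun_prop
  · refine (Integrable.fintype_prod (f := fun j z => ‖f j (m k j) z‖ ^ 2 * Real.exp (-φ j z))
      fun j => hfi j (m k j)).congr (Eventually.of_forall fun z => ?_)
    simp only [norm_prod, ← Finset.sum_neg_distrib, Real.exp_sum, ← Finset.prod_pow,
      Finset.prod_mul_distrib]
  · have hx : ∀ j, ∃ x, f j 0 x ≠ 0 := fun j => by
      by_contra hne
      push Not at hne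
      exact (hfl j).ne_zero 0 (funext hne)
    choose x hx using hx
    let T : ((Fin n → ℂ) → ℂ) →ₗ[ℂ] (ℂ → ℂ) :=
      LinearMap.funLeft ℂ ℂ fun w => Function.update x i₀ w
    refine LinearIndependent.of_comp T ?_
    set c : ℂ := ∏ j ∈ Finset.univ.erase i₀, f j 0 (x j) with hc
    have hc0 : c ≠ 0 := Finset.prod_ne_zero_iff.2 fun j _ => hx j
    have h := (hfl i₀).units_smul fun _ => Units.mk0 c hc0
    convert h using 1
    ext k w
    change ∏ j, f j (m k j) (Function.update x i₀ w j) = c * f i₀ k w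
    rw [← Finset.mul_prod_erase Finset.univ _ (Finset.mem_univ i₀), mul_comm, hc]
    congr 1
    refine Finset.prod_congr rfl fun j hj => ?_
    have hj' : j ≠ i₀ := Finset.ne_of_mem_erase hj
    simp [m, hj']

/-- Let `n ≥ 2`, let `φ_j : ℂ → ℝ` be subharmonic `C²` functions such that
each `Δφ_j dλ` is a nontrivial doubling measure on `ℂ`, and set
`φ(z₁,…,zₙ) = φ₁(z₁) + ⋯ + φₙ(zₙ)`. Then the weighted Bergman space `A²(ℂⁿ, e^{-φ})`
is an infinite-dimensional complex vector space. -/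
theorem bergman_space_infinite_dimensional_decoupled
    (n : ℕ) (hn : 2 ≤ n) (φ : Fin n → ℂ → ℝ)
    (hφC2 : ∀ j, ContDiff ℝ 2 (φ j))
    (hsub : ∀ j z, 0 ≤ lap (φ j) z)
    (μ : Fin n → Measure ℂ)
    (hμdef : ∀ j, μ j = volume.withDensity fun z => ENNReal.ofReal (lap (φ j) z))
    (hμne : ∀ j, μ j ≠ 0)
    (hdoubling : ∀ j, ∃ C : ℝ, 0 < C ∧ ∀ (z : ℂ) (r : ℝ), 0 < r →
      μ j (Metric.ball z r) ≤ ENNReal.ofReal C * μ j (Metric.ball z (r / 2))) :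
    ∃ g : ℕ → (Fin n → ℂ) → ℂ,
      (∀ k, Differentiable ℂ (g k) ∧
        Integrable (fun z => ‖g k z‖ ^ 2 * Real.exp (-(∑ j, φ j (z j))))) ∧
      LinearIndependent ℂ g := by
  have hf : ∀ j, ∃ f : ℕ → ℂ → ℂ, (∀ k, Differentiable ℂ (f k) ∧
      Integrable fun z => ‖f k z‖ ^ 2 * Real.exp (-φ j z)) ∧ LinearIndependent ℂ f := by
    intro j
    obtain ⟨C, -, hC⟩ := hdoubling j
    have htop := measure_univ_eq_top_of_doubling (hμne j) hC
    rw [hμdef j, withDensity_apply _ MeasurableSet.univ, Measure.restrict_univ] at htop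
    exact exists_linearIndependent_entire (hφC2 j) (hsub j) htop
  choose f hfd hfl using hf
  exact exists_linearIndependent_entire_pi (by omega) (fun j k => (hfd j k).1)
    (fun j k => (hfd j k).2) hfl
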